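/- Let 𝒟 be any family of generalized dependencies. Then FO(∼₀, 𝒟) ≡ FO (every sentence of FO(∼₀, 𝒟) is equivalent to a first-order sentence) if and only if FO(𝒟, ∼𝒟) ≡ FO. -/

import Mathlib

namespace DSFO

/-- A purely relational signature: for each arity, a type of relation symbols. -/
abbrev Signature := ℕ → Type

/-- The empty signature. -/
def Sig0 : Signature := fun _ => Empty

/-- The signature with a single `k`-ary relation symbol `R`. -/
def SigR (k : ℕ) : Signature := fun n => PLift (n = k)

/-- Syntax of team-semantics formulas (in negation normal form, with the two
additional connectives: global disjunction `gdisj` and contradictory negation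
`cneg`) over a relational signature `S`, with generalized dependency atoms
indexed by `ι` with arities `ar`.  Variables are natural numbers. -/
inductive TS (S : Signature) (ι : Type) (ar : ι → ℕ) : Type
  | rel {k : ℕ} (r : S k) (v : Fin k → ℕ)
  | nrel {k : ℕ} (r : S k) (v : Fin k → ℕ)
  | eq (x y : ℕ)
  | neq (x y : ℕ)
  | dep (i : ι) (v : Fin (ar i) → ℕ)
  | and (φ ψ : TS S ι ar)
  | or (φ ψ : TS S ι ar)
  | gdisj (φ ψ : TS S ι ar)
  | cneg (φ : TS S ι ar)
  | ex (v : ℕ) (φ : TS S ι ar)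
  | al (v : ℕ) (φ : TS S ι ar)

/-- The always-true literal `⊤`. -/
def TS.top {S : Signature} {ι : Type} {ar : ι → ℕ} : TS S ι ar := .eq 0 0

/-- The arity function for "no dependency atoms". -/
def noAtoms : Empty → ℕ := fun e => e.elim

/-- First-order formulas over `S` (no dependency atoms; here `cneg` plays the
role of ordinary classical negation and `gdisj` of ordinary disjunction, so
this is full first-order logic). -/
abbrev FOF (S : Signature) := TS S Empty noAtoms

/-- First-order formulas over the empty signature. -/
abbrev EF := FOF Sig0

/-- Free variables of a formula. -/
def fv {S : Signature} {ι : Type} {ar : ι → ℕ} : TS S ι ar → Set ℕ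
  | .rel _ v => Set.range v
  | .nrel _ v => Set.range v
  | .eq x y => {x, y}
  | .neq x y => {x, y}
  | .dep _ v => Set.range v
  | .and φ ψ => fv φ ∪ fv ψ
  | .or φ ψ => fv φ ∪ fv ψ
  | .gdisj φ ψ => fv φ ∪ fv ψ
  | .cneg φ => fv φ
  | .ex v φ => fv φ \ {v}
  | .al v φ => fv φ \ {v}

/-- A sentence is a formula with no free variables. -/
def IsSentence {S : Signature} {ι : Type} {ar : ι → ℕ} (φ : TS S ι ar) : Prop :=
  fv φ = ∅

/-- No global disjunctions occur. -/
def NoGdisj {S : Signature} {ι : Type} {ar : ι → ℕ} : TS S ι ar → Prop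
  | .rel _ _ => True
  | .nrel _ _ => True
  | .eq _ _ => True
  | .neq _ _ => True
  | .dep _ _ => True
  | .and φ ψ => NoGdisj φ ∧ NoGdisj ψ
  | .or φ ψ => NoGdisj φ ∧ NoGdisj ψ
  | .gdisj _ _ => False
  | .cneg φ => NoGdisj φ
  | .ex _ φ => NoGdisj φ
  | .al _ φ => NoGdisj φ

/-- No contradictory negations occur. -/
def NoCneg {S : Signature} {ι : Type} {ar : ι → ℕ} : TS S ι ar → Prop
  | .rel _ _ => True
  | .nrel _ _ => True
  | .eq _ _ => True
  | .neq _ _ => True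
  | .dep _ _ => True
  | .and φ ψ => NoCneg φ ∧ NoCneg ψ
  | .or φ ψ => NoCneg φ ∧ NoCneg ψ
  | .gdisj φ ψ => NoCneg φ ∧ NoCneg ψ
  | .cneg _ => False
  | .ex _ φ => NoCneg φ
  | .al _ φ => NoCneg φ

/-- Formulas of `FO(𝒟)` proper: no `gdisj` and no `cneg`. -/
def Plain {S : Signature} {ι : Type} {ar : ι → ℕ} (φ : TS S ι ar) : Prop :=
  NoCneg φ ∧ NoGdisj φ

/-- Atomic formulas: first-order literals and dependency atoms. -/
def Atomic {S : Signature} {ι : Type} {ar : ι → ℕ} : TS S ι ar → Prop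
  | .rel _ _ => True
  | .nrel _ _ => True
  | .eq _ _ => True
  | .neq _ _ => True
  | .dep _ _ => True
  | _ => False

/-- Formulas of `FO(∼₀, 𝒟)`: the contradictory negation may appear only in
front of first-order literals and dependency atoms (and there is no `gdisj`). -/
def Cneg0 {S : Signature} {ι : Type} {ar : ι → ℕ} : TS S ι ar → Prop
  | .rel _ _ => True
  | .nrel _ _ => True
  | .eq _ _ => True
  | .neq _ _ => True
  | .dep _ _ => True
  | .and φ ψ => Cneg0 φ ∧ Cneg0 ψ
  | .or φ ψ => Cneg0 φ ∧ Cneg0 ψ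
  | .gdisj _ _ => False
  | .cneg φ => Atomic φ
  | .ex _ φ => Cneg0 φ
  | .al _ φ => Cneg0 φ

/-- The negation normal form of the (dual) negation of a formula. -/
def TS.nneg {S : Signature} {ι : Type} {ar : ι → ℕ} : TS S ι ar → TS S ι ar
  | .rel r v => .nrel r v
  | .nrel r v => .rel r v
  | .eq x y => .neq x y
  | .neq x y => .eq x y
  | .dep i v => .cneg (.dep i v)
  | .and φ ψ => .or (TS.nneg φ) (TS.nneg ψ)
  | .or φ ψ => .and (TS.nneg φ) (TS.nneg ψ)
  | .gdisj φ ψ => .and (TS.nneg φ) (TS.nneg ψ)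
  | .cneg φ => φ
  | .ex v φ => .al v (TS.nneg φ)
  | .al v φ => .ex v (TS.nneg φ)

/-- Iterated existential quantification over a list of variables. -/
def exs {S : Signature} {ι : Type} {ar : ι → ℕ} (l : List ℕ) (φ : TS S ι ar) :
    TS S ι ar := l.foldr TS.ex φ

/-- An interpretation of a relational signature in a domain `M`. -/
abbrev Interp (S : Signature) (M : Type) := ∀ k, S k → Set (Fin k → M)

/-- The unique interpretation of the empty signature. -/
def eI (M : Type) : Interp Sig0 M := fun _ e => e.elim

/-- The interpretation of `SigR k` given by a `k`-ary relation `R`. -/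
def interpR {k : ℕ} {M : Type} (R : Set (Fin k → M)) : Interp (SigR k) M :=
  fun _ r => {s | (fun i => s (Fin.cast r.down.symm i)) ∈ R}

/-- Tarskian (single-assignment) satisfaction.  Dependency atoms are
(vacuously) interpreted as true; this is only used on first-order formulas. -/
def FSat {S : Signature} {ι : Type} {ar : ι → ℕ} (M : Type) (I : Interp S M) :
    (ℕ → M) → TS S ι ar → Prop
  | s, .rel r v => (fun i => s (v i)) ∈ I _ r
  | s, .nrel r v => (fun i => s (v i)) ∉ I _ r
  | s, .eq x y => s x = s y
  | s, .neq x y => s x ≠ s y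
  | _, .dep _ _ => True
  | s, .and φ ψ => FSat M I s φ ∧ FSat M I s ψ
  | s, .or φ ψ => FSat M I s φ ∨ FSat M I s ψ
  | s, .gdisj φ ψ => FSat M I s φ ∨ FSat M I s ψ
  | s, .cneg φ => ¬ FSat M I s φ
  | s, .ex v φ => ∃ m : M, FSat M I (Function.update s v m) φ
  | s, .al v φ => ∀ m : M, FSat M I (Function.update s v m) φ

/-- Truth of a first-order sentence (Tarskian semantics). -/
def FOTrue {S : Signature} {ι : Type} {ar : ι → ℕ} (M : Type) (I : Interp S M)
    (φ : TS S ι ar) : Prop :=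
  ∀ s : ℕ → M, FSat M I s φ

/-- The relation `X(x̄)` determined by a team `X` and a tuple of variables `x̄`. -/
def teamProj {M : Type} {k : ℕ} (v : Fin k → ℕ) (X : Set (ℕ → M)) :
    Set (Fin k → M) := {t | ∃ s ∈ X, t = fun j => s (v j)}

/-- (Lax) team semantics.  `A` gives the semantics of each dependency atom as a
function of the relation `X(x̄)`. -/
def TSat {S : Signature} {ι : Type} {ar : ι → ℕ} (M : Type) (I : Interp S M)
    (A : ∀ i, Set (Fin (ar i) → M) → Prop) :
    TS S ι ar → Set (ℕ → M) → Prop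
  | .rel r v, X => ∀ s ∈ X, (fun i => s (v i)) ∈ I _ r
  | .nrel r v, X => ∀ s ∈ X, (fun i => s (v i)) ∉ I _ r
  | .eq x y, X => ∀ s ∈ X, s x = s y
  | .neq x y, X => ∀ s ∈ X, s x ≠ s y
  | .dep i v, X => A i (teamProj v X)
  | .and φ ψ, X => TSat M I A φ X ∧ TSat M I A ψ X
  | .or φ ψ, X => ∃ Y Z : Set (ℕ → M), Y ∪ Z = X ∧ TSat M I A φ Y ∧ TSat M I A ψ Z
  | .gdisj φ ψ, X => TSat M I A φ X ∨ TSat M I A ψ X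
  | .cneg φ, X => ¬ TSat M I A φ X
  | .ex v φ, X => ∃ H : (ℕ → M) → Set M, (∀ s ∈ X, (H s).Nonempty) ∧
      TSat M I A φ {s' | ∃ s ∈ X, ∃ m ∈ H s, s' = Function.update s v m}
  | .al v φ, X => TSat M I A φ {s' | ∃ s ∈ X, ∃ m : M, s' = Function.update s v m}

/-- Truth of a sentence under team semantics: satisfaction by the team of all
assignments (by locality, equivalent to satisfaction by `{∅}`). -/
def TTrue {S : Signature} {ι : Type} {ar : ι → ℕ} (M : Type) (I : Interp S M)
    (A : ∀ i, Set (Fin (ar i) → M) → Prop) (φ : TS S ι ar) : Prop :=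
  TSat M I A φ Set.univ

/-- A `k`-ary dependency predicate: a class of pairs `(M, R)`. -/
abbrev DepPred (k : ℕ) := ∀ M : Type, Set (Fin k → M) → Prop

/-- Closure under isomorphisms (part of the definition of a generalized
dependency). -/
def IsoClosed {k : ℕ} (D : DepPred k) : Prop :=
  ∀ (M N : Type) (e : M ≃ N) (R : Set (Fin k → M)),
    D M R → D N ((fun f => e ∘ f) '' R)

/-- The complement `∼D` of a dependency. -/
def complD {k : ℕ} (D : DepPred k) : DepPred k := fun M R => ¬ D M R

def DownwardsClosed {k : ℕ} (D : DepPred k) : Prop :=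
  ∀ (M : Type) (R R' : Set (Fin k → M)), D M R → R' ⊆ R → D M R'

/-- The downwards closure `D↓`. -/
def dClosure {k : ℕ} (D : DepPred k) : DepPred k :=
  fun M R => ∃ R', R ⊆ R' ∧ D M R'

/-- `D_max`: the maximal models of `D`. -/
def DMax {k : ℕ} (D : DepPred k) : DepPred k :=
  fun M R => D M R ∧ ∀ R', R ⊂ R' → ¬ D M R'

/-- The empty team property. -/
def EmptyTeamProp {k : ℕ} (D : DepPred k) : Prop :=
  ∀ M : Type, Nontrivial M → D M (∅ : Set (Fin k → M))

/-- `D` is a first-order dependency: it is the class of models of a first-order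
sentence over the signature `{R}`. -/
def FirstOrderDep {k : ℕ} (D : DepPred k) : Prop :=
  ∃ ψ : FOF (SigR k), IsSentence ψ ∧
    ∀ (M : Type), Nontrivial M → ∀ R : Set (Fin k → M),
      (D M R ↔ FOTrue M (interpR R) ψ)

/-- The interpretation of a unary predicate symbol as a subset of the domain. -/
def PSet {S : Signature} {M : Type} (I : Interp S M) (P : S 1) : Set M :=
  {m | (fun _ => m) ∈ I 1 P}

/-- Semantics of the relativization `D^(P)` of `D` to the unary predicate `P`:
`𝔐 ⊨_X D^(P) x̄` iff `(P^𝔐, X(x̄)) ∈ D`. -/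
def relSem {k : ℕ} (D : DepPred k) {S : Signature} (P : S 1)
    (M : Type) (I : Interp S M) (R : Set (Fin k → M)) : Prop :=
  (∀ f ∈ R, ∀ j, f j ∈ PSet I P) ∧
    D (↥(PSet I P)) {g : Fin k → ↥(PSet I P) | (fun j => (g j : M)) ∈ R}

/-- A family `𝒟` of generalized dependencies is strongly first order: every
sentence of `FO(𝒟)` is equivalent to some first-order sentence. -/
def SFOFam {ι : Type} {ar : ι → ℕ} (D : ∀ i, DepPred (ar i)) : Prop :=
  ∀ (S : Signature) (φ : TS S ι ar), IsSentence φ → Plain φ →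
    ∃ ψ : FOF S, IsSentence ψ ∧
      ∀ (M : Type), Nontrivial M → ∀ I : Interp S M,
        (TTrue M I (fun i => D i M) φ ↔ FOTrue M I ψ)

/-- A single dependency is strongly first order iff `{D}` is. -/
def SFOd {k : ℕ} (D : DepPred k) : Prop :=
  SFOFam (ι := Unit) (ar := fun _ => k) (fun _ => D)

/-- A family `𝒟` is relativizable: every sentence of `FO(𝒟^(P))` is equivalent
to some sentence of `FO(𝒟)`. -/
def RelativizableFam {ι : Type} {ar : ι → ℕ} (D : ∀ i, DepPred (ar i)) : Prop :=
  ∀ (S : Signature) (P : S 1) (φ : TS S ι ar), IsSentence φ → Plain φ →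
    ∃ ψ : TS S ι ar, IsSentence ψ ∧ Plain ψ ∧
      ∀ (M : Type), Nontrivial M → ∀ I : Interp S M,
        (TTrue M I (fun i => relSem (D i) P M I) φ ↔ TTrue M I (fun i => D i M) ψ)

def Relativizable1 {k : ℕ} (D : DepPred k) : Prop :=
  RelativizableFam (ι := Unit) (ar := fun _ => k) (fun _ => D)

/-- The family `𝒟 ∪ ∼𝒟`. -/
def withComplFam {ι : Type} {ar : ι → ℕ} (D : ∀ i, DepPred (ar i)) :
    ∀ i : ι ⊕ ι, DepPred (Sum.elim ar ar i) :=
  fun i => match i with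
    | .inl a => D a
    | .inr a => complD (D a)

/-- `D` is doubly strongly first order: `{D, ∼D}` is strongly first order. -/
def DSFOd {k : ℕ} (D : DepPred k) : Prop :=
  SFOFam (ι := Bool) (ar := fun _ => k)
    (fun b => match b with | true => D | false => complD D)

/-- The constancy atom of arity `k`. -/
def constD (k : ℕ) : DepPred k := fun _ R => ∀ f ∈ R, ∀ g ∈ R, f = g

/-- The totality atom of arity `k`. -/
def allD (k : ℕ) : DepPred k := fun M R => R = (Set.univ : Set (Fin k → M))

/-- The family `𝒟 ∪ {const}` (constancy atoms of every arity). -/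
def withConst {ι : Type} {ar : ι → ℕ} (D : ∀ i, DepPred (ar i)) :
    ∀ i : ι ⊕ ℕ, DepPred (Sum.elim ar id i) :=
  fun i => match i with
    | .inl a => D a
    | .inr n => constD n

/-- The atoms of `𝒟^(P) ∪ {const}`. -/
def withConstRel {ι : Type} {ar : ι → ℕ} (D : ∀ i, DepPred (ar i))
    {S : Signature} (P : S 1) (M : Type) (I : Interp S M) :
    ∀ i : ι ⊕ ℕ, Set (Fin (Sum.elim ar id i) → M) → Prop :=
  fun i => match i with
    | .inl a => relSem (D a) P M I
    | .inr n => constD n M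

/-- Atom indices of the logic `FO(𝒟₀, ⊔, const, All)`: the 0-ary first-order
dependencies `[ψ]`, the constancy atoms and the totality atoms. -/
inductive CIdx : Type
  | d0 (ψ : EF) (hψ : IsSentence ψ)
  | const (k : ℕ)
  | total (k : ℕ)

def cAr : CIdx → ℕ
  | .d0 _ _ => 0
  | .const k => k
  | .total k => k

def cSem (M : Type) : ∀ i : CIdx, Set (Fin (cAr i) → M) → Prop
  | .d0 ψ _, _ => FOTrue M (eI M) ψ
  | .const _, R => ∀ f ∈ R, ∀ g ∈ R, f = g
  | .total _, R => R = Set.univ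

/-- Embedding of first-order formulas over the empty signature into any
team logic. -/
def embedEF {S : Signature} {ι : Type} {ar : ι → ℕ} : EF → TS S ι ar
  | .rel r _ => Empty.elim r
  | .nrel r _ => Empty.elim r
  | .eq x y => .eq x y
  | .neq x y => .neq x y
  | .dep i _ => Empty.elim i
  | .and φ ψ => .and (embedEF φ) (embedEF ψ)
  | .or φ ψ => .or (embedEF φ) (embedEF ψ)
  | .gdisj φ ψ => .gdisj (embedEF φ) (embedEF ψ)
  | .cneg φ => .cneg (embedEF φ)
  | .ex v φ => .ex v (embedEF φ)
  | .al v φ => .al v (embedEF φ)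

/-- Override the values of the variables `0, …, k-1` by the tuple `f`. -/
def overrideFin {M : Type} (k : ℕ) (f : Fin k → M) (s : ℕ → M) : ℕ → M :=
  fun v => if h : v < k then f ⟨v, h⟩ else s v

/-- `(M, R) ⊨ ∃ȳ ∀x̄ (R x̄ → θ(x̄, ȳ))`, where `x̄` is the tuple of variables
`0, …, k-1` and the remaining free variables `ȳ` of `θ` are witnessed by `s`. -/
def ExAllSem {k : ℕ} (M : Type) (R : Set (Fin k → M)) (θ : EF) : Prop :=
  ∃ s : ℕ → M, ∀ f ∈ R, FSat M (eI M) (overrideFin k f s) θ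

/-- `(M, R) ⊨ ∃ȳ ∀x̄ (R x̄ ↔ θ(x̄, ȳ))`. -/
def ExAllIffSem {k : ℕ} (M : Type) (R : Set (Fin k → M)) (θ : EF) : Prop :=
  ∃ s : ℕ → M, ∀ f : Fin k → M, (f ∈ R ↔ FSat M (eI M) (overrideFin k f s) θ)

/-- The assignment sending `x̄ = (0, …, k-1)` to `f`, `ȳ = (k, …, k+n-1)` to
`a`, and every other variable to its value under `s0`. -/
def tupAsg {M : Type} (k n : ℕ) (f : Fin k → M) (a : Fin n → M) (s0 : ℕ → M) :
    ℕ → M :=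
  fun v => if h : v < k then f ⟨v, h⟩ else if h2 : v - k < n then a ⟨v - k, h2⟩ else s0 v

/-- `R` is defined by the formula `θ(x̄, ȳ)` (with `x̄ = (0, …, k-1)` and
`ȳ = (k, …, k+n-1)`): there is a tuple `ā` of parameters such that
`R = {m̄ : 𝔐 ⊨ θ(m̄, ā)}`. -/
def DefinedBy {S : Signature} {M : Type} (I : Interp S M) (k n : ℕ)
    (θ : FOF S) (R : Set (Fin k → M)) : Prop :=
  ∃ a : Fin n → M, ∀ s0 : ℕ → M, R = {f | FSat M I (tupAsg k n f a s0) θ}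

/-- `θ(x̄, ȳ)` fixes the identity type of `ȳ = (k, …, k+n-1)`. -/
def FixesIdType {S : Signature} (k n : ℕ) (θ : FOF S) : Prop :=
  ∀ i j : Fin n,
    (∀ (M : Type), Nontrivial M → ∀ (I : Interp S M) (s : ℕ → M),
        FSat M I s θ → s (k + (i : ℕ)) = s (k + (j : ℕ))) ∨
    (∀ (M : Type), Nontrivial M → ∀ (I : Interp S M) (s : ℕ → M),
        FSat M I s θ → s (k + (i : ℕ)) ≠ s (k + (j : ℕ)))

/-- `(M, R := Xv) ⊨ ∃ȳ ∀x̄ (R x̄ → θ(x̄, ȳ))` where the `x̄`-slots of `θ` are the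
variables `v̄` and the `ȳ`-slots are the variables `ȳ`. -/
def projExAll {M : Type} {k n : ℕ} (v : Fin k → ℕ) (y : Fin n → ℕ) (θ : EF)
    (Xv : Set (Fin k → M)) : Prop :=
  ∃ b : Fin n → M, ∀ f ∈ Xv, ∀ s : ℕ → M,
    (∀ j, s (v j) = f j) → (∀ i, s (y i) = b i) → FSat M (eI M) s θ


/-! ### Locality -/

section Locality

variable {S : Signature} {ι : Type} {ar : ι → ℕ} {M : Type}

/-- Every assignment of `X` agrees on `V` with some assignment of `Y`. -/
def Covers (V : Set ℕ) (X Y : Set (ℕ → M)) : Prop :=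
  ∀ x ∈ X, ∃ y ∈ Y, Set.EqOn x y V

theorem Covers.mono {V W : Set ℕ} {X Y : Set (ℕ → M)} (h : Covers W X Y) (hVW : V ⊆ W) :
    Covers V X Y := fun x hx =>
  let ⟨y, hy, e⟩ := h x hx
  ⟨y, hy, e.mono hVW⟩

theorem eqOn_update {V : Set ℕ} {v : ℕ} {x y : ℕ → M} (h : Set.EqOn x y (V \ {v})) (m : M) :
    Set.EqOn (Function.update x v m) (Function.update y v m) V := by
  intro n hn
  by_cases hv : n = v
  · subst hv; simp
  · simpa [hv] using h ⟨hn, hv⟩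

theorem eqOn_update_left {V : Set ℕ} {v : ℕ} (hv : v ∉ V) (x : ℕ → M) (m : M) :
    Set.EqOn (Function.update x v m) x V := by
  intro n hn
  have : n ≠ v := fun e => hv (e ▸ hn)
  simp [this]

theorem teamProj_subset {k : ℕ} {v : Fin k → ℕ} {X Y : Set (ℕ → M)}
    (h : Covers (Set.range v) X Y) : teamProj v X ⊆ teamProj v Y := by
  rintro t ⟨s, hs, rfl⟩
  obtain ⟨y, hy, e⟩ := h s hs
  exact ⟨y, hy, funext fun j => e ⟨j, rfl⟩⟩

/-- Locality of team semantics: satisfaction depends only on the restriction of the team to the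
free variables. -/
theorem TSat.local (I : Interp S M) (A : ∀ i, Set (Fin (ar i) → M) → Prop) (φ : TS S ι ar) :
    ∀ X Y : Set (ℕ → M), Covers (fv φ) X Y → Covers (fv φ) Y X →
      TSat M I A φ X → TSat M I A φ Y := by
  induction φ with
  | rel r v =>
    intro X Y _ h2 h s hs
    obtain ⟨x, hx, e⟩ := h2 s hs
    have : (fun i => s (v i)) = fun i => x (v i) := funext fun j => e ⟨j, rfl⟩
    rw [this]; exact h x hx
  | nrel r v =>
    intro X Y _ h2 h s hs
    obtain ⟨x, hx, e⟩ := h2 s hs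
    have : (fun i => s (v i)) = fun i => x (v i) := funext fun j => e ⟨j, rfl⟩
    rw [this]; exact h x hx
  | eq a b =>
    intro X Y _ h2 h s hs
    obtain ⟨x, hx, e⟩ := h2 s hs
    rw [e (Or.inl rfl), e (Or.inr rfl)]; exact h x hx
  | neq a b =>
    intro X Y _ h2 h s hs
    obtain ⟨x, hx, e⟩ := h2 s hs
    rw [e (Or.inl rfl), e (Or.inr rfl)]; exact h x hx
  | dep i v =>
    intro X Y h1 h2 h
    have : teamProj v X = teamProj v Y :=
      (teamProj_subset h1).antisymm (teamProj_subset h2)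
    simpa only [TSat, this] using h
  | and φ ψ ihφ ihψ =>
    intro X Y h1 h2 h
    exact ⟨ihφ X Y (h1.mono Set.subset_union_left) (h2.mono Set.subset_union_left) h.1,
      ihψ X Y (h1.mono Set.subset_union_right) (h2.mono Set.subset_union_right) h.2⟩
  | gdisj φ ψ ihφ ihψ =>
    intro X Y h1 h2 h
    exact h.imp (ihφ X Y (h1.mono Set.subset_union_left) (h2.mono Set.subset_union_left))
      (ihψ X Y (h1.mono Set.subset_union_right) (h2.mono Set.subset_union_right))
  | cneg φ ih =>
    intro X Y h1 h2 h h'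
    exact h (ih Y X h2 h1 h')
  | or φ ψ ihφ ihψ =>
    rintro X X' h1 h2 ⟨Y, Z, rfl, hY, hZ⟩
    have key : ∀ W ⊆ Y ∪ Z, Covers (fv (TS.or φ ψ)) W
        {x ∈ X' | ∃ w ∈ W, Set.EqOn x w (fv (TS.or φ ψ))} := by
      intro W hW w hw
      obtain ⟨x, hx, e⟩ := h1 w (hW hw)
      exact ⟨x, ⟨hx, w, hw, e.symm⟩, e⟩
    have key' : ∀ W, Covers (fv (TS.or φ ψ))
        {x ∈ X' | ∃ w ∈ W, Set.EqOn x w (fv (TS.or φ ψ))} W := fun W x hx => hx.2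
    refine ⟨{x ∈ X' | ∃ w ∈ Y, Set.EqOn x w (fv (TS.or φ ψ))},
      {x ∈ X' | ∃ w ∈ Z, Set.EqOn x w (fv (TS.or φ ψ))}, ?_,
      ihφ Y _ ((key Y Set.subset_union_left).mono Set.subset_union_left)
        ((key' Y).mono Set.subset_union_left) hY,
      ihψ Z _ ((key Z Set.subset_union_right).mono Set.subset_union_right)
        ((key' Z).mono Set.subset_union_right) hZ⟩
    ext x
    constructor
    · rintro (h | h) <;> exact h.1
    · intro hx
      obtain ⟨w, hw | hw, e⟩ := h2 x hx
      · exact Or.inl ⟨hx, w, hw, e⟩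
      · exact Or.inr ⟨hx, w, hw, e⟩
  | ex v φ ih =>
    rintro X Y h1 h2 ⟨H, hH, h⟩
    refine ⟨fun y => {m | ∃ x ∈ X, Set.EqOn y x (fv φ \ {v}) ∧ m ∈ H x}, ?_, ih _ _ ?_ ?_ h⟩
    · intro y hy
      obtain ⟨x, hx, e⟩ := h2 y hy
      obtain ⟨m, hm⟩ := hH x hx
      exact ⟨m, x, hx, e, hm⟩
    · rintro _ ⟨x, hx, m, hm, rfl⟩
      obtain ⟨y, hy, e⟩ := h1 x hx
      exact ⟨_, ⟨y, hy, m, ⟨x, hx, e.symm, hm⟩, rfl⟩, eqOn_update e m⟩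
    · rintro _ ⟨y, hy, m, ⟨x, hx, e, hm⟩, rfl⟩
      exact ⟨_, ⟨x, hx, m, hm, rfl⟩, eqOn_update e m⟩
  | al v φ ih =>
    have key : ∀ X Y : Set (ℕ → M), Covers (fv φ \ {v}) X Y →
        Covers (fv φ) {s' | ∃ s ∈ X, ∃ m : M, s' = Function.update s v m}
          {s' | ∃ s ∈ Y, ∃ m : M, s' = Function.update s v m} := by
      rintro X Y h _ ⟨x, hx, m, rfl⟩
      obtain ⟨y, hy, e⟩ := h x hx
      exact ⟨_, ⟨y, hy, m, rfl⟩, eqOn_update e m⟩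
    intro X Y h1 h2 h
    exact ih _ _ (key X Y h1) (key Y X h2) h

end Locality

/-! ### Literals and negated literals -/

section Literals

variable {S : Signature} {ι : Type} {ar : ι → ℕ}

/-- First-order literals. -/
def IsLit : TS S ι ar → Prop
  | .rel _ _ => True
  | .nrel _ _ => True
  | .eq _ _ => True
  | .neq _ _ => True
  | _ => False

/-- Formulas without global disjunction in which the contradictory negation occurs only in front
of first-order literals. -/
def LitCneg : TS S ι ar → Prop
  | .and φ ψ => LitCneg φ ∧ LitCneg ψ
  | .or φ ψ => LitCneg φ ∧ LitCneg ψ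
  | .gdisj _ _ => False
  | .cneg φ => IsLit φ
  | .ex _ φ => LitCneg φ
  | .al _ φ => LitCneg φ
  | _ => True

/-- The number of contradictory negations in a formula. -/
def cnegs : TS S ι ar → ℕ
  | .and φ ψ => cnegs φ + cnegs ψ
  | .or φ ψ => cnegs φ + cnegs ψ
  | .gdisj φ ψ => cnegs φ + cnegs ψ
  | .cneg φ => cnegs φ + 1
  | .ex _ φ => cnegs φ
  | .al _ φ => cnegs φ
  | _ => 0

/-- A strict upper bound for all variables, free or bound, of a formula. -/
def varBound : TS S ι ar → ℕ
  | .rel _ v => Finset.univ.sup v + 1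
  | .nrel _ v => Finset.univ.sup v + 1
  | .eq x y => max x y + 1
  | .neq x y => max x y + 1
  | .dep _ v => Finset.univ.sup v + 1
  | .and φ ψ => max (varBound φ) (varBound ψ)
  | .or φ ψ => max (varBound φ) (varBound ψ)
  | .gdisj φ ψ => max (varBound φ) (varBound ψ)
  | .cneg φ => varBound φ
  | .ex v φ => max (v + 1) (varBound φ)
  | .al v φ => max (v + 1) (varBound φ)

theorem lt_varBound (φ : TS S ι ar) : ∀ n ∈ fv φ, n < varBound φ := by
  have tup : ∀ {k : ℕ} (v : Fin k → ℕ), ∀ n ∈ Set.range v, n < Finset.univ.sup v + 1 := by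
    rintro k v _ ⟨j, rfl⟩
    exact Nat.lt_succ_of_le (Finset.le_sup (f := v) (Finset.mem_univ j))
  induction φ with
  | rel r v => exact tup v
  | nrel r v => exact tup v
  | dep i v => exact tup v
  | eq x y => rintro n (rfl | rfl) <;> simp only [varBound] <;> omega
  | neq x y => rintro n (rfl | rfl) <;> simp only [varBound] <;> omega
  | and φ ψ h1 h2 => rintro n (h | h) <;> simp [varBound, h1, h2, h]
  | or φ ψ h1 h2 => rintro n (h | h) <;> simp [varBound, h1, h2, h]
  | gdisj φ ψ h1 h2 => rintro n (h | h) <;> simp [varBound, h1, h2, h]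
  | cneg φ h => exact h
  | ex v φ h1 => rintro n ⟨h, _⟩; simp [varBound, h1, h]
  | al v φ h1 => rintro n ⟨h, _⟩; simp [varBound, h1, h]

theorem LitCneg.plain {φ : TS S ι ar} (h : LitCneg φ) (h0 : cnegs φ = 0) : Plain φ := by
  unfold Plain
  induction φ <;> simp_all [LitCneg, cnegs, NoCneg, NoGdisj]

theorem IsLit.tsat_iff {M : Type} {I : Interp S M} {A : ∀ i, Set (Fin (ar i) → M) → Prop}
    {α : TS S ι ar} (h : IsLit α) (X : Set (ℕ → M)) :
    TSat M I A α X ↔ ∀ s ∈ X, FSat M I s α := by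
  cases α <;> simp_all [IsLit, TSat, FSat]

theorem IsLit.tsat_nneg_iff {M : Type} {I : Interp S M}
    {A : ∀ i, Set (Fin (ar i) → M) → Prop} {α : TS S ι ar} (h : IsLit α) (X : Set (ℕ → M)) :
    TSat M I A α.nneg X ↔ ∀ s ∈ X, ¬ FSat M I s α := by
  cases α <;> simp_all [IsLit, TSat, FSat, TS.nneg]

theorem IsLit.fsat_congr {M : Type} {I : Interp S M} {α : TS S ι ar} (h : IsLit α)
    {s t : ℕ → M} (e : Set.EqOn s t (fv α)) (hs : FSat M I s α) : FSat M I t α := by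
  refine (h.tsat_iff (A := fun _ _ => True) {t}).1 (TSat.local I _ α {s} {t} ?_ ?_ ?_) t rfl
  · rintro _ rfl; exact ⟨t, rfl, e⟩
  · rintro _ rfl; exact ⟨s, rfl, e.symm⟩
  · rw [h.tsat_iff]; rintro _ rfl; exact hs

theorem IsLit.litCneg_nneg {α : TS S ι ar} (h : IsLit α) : LitCneg α.nneg := by
  cases α <;> simp_all [IsLit, LitCneg, TS.nneg]

theorem IsLit.cnegs_nneg {α : TS S ι ar} (h : IsLit α) : cnegs α.nneg = 0 := by
  cases α <;> simp_all [IsLit, cnegs, TS.nneg]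

theorem IsLit.fv_nneg {α : TS S ι ar} (h : IsLit α) : fv α.nneg = fv α := by
  cases α <;> simp_all [IsLit, fv, TS.nneg]

end Literals

/-! ### Flags

A list of pairs of variables marks, or flags, the assignments that identify all the pairs.  Flagged
assignments serve as witnesses of a contradictorily negated literal. -/

section Flags

variable {S : Signature} {ι : Type} {ar : ι → ℕ} {M : Type}

/-- The assignment `s` identifies all pairs of variables in `F`. -/
def Flagged (F : List (ℕ × ℕ)) (s : ℕ → M) : Prop := ∀ p ∈ F, s p.1 = s p.2

/-- The variables occurring in `F`. -/
def flagVars (F : List (ℕ × ℕ)) : Set ℕ := {n | ∃ p ∈ F, n = p.1 ∨ n = p.2}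

/-- The formula stating that flagged assignments satisfy `θ`. -/
def guard (F : List (ℕ × ℕ)) (θ : TS S ι ar) : TS S ι ar :=
  F.foldr (fun p χ => .or (.neq p.1 p.2) χ) θ

theorem flagVars_cons (a b : ℕ) (F : List (ℕ × ℕ)) :
    flagVars ((a, b) :: F) = {a, b} ∪ flagVars F := by
  ext n; simp [flagVars]

theorem flagged_cons (a b : ℕ) (F : List (ℕ × ℕ)) (s : ℕ → M) :
    Flagged ((a, b) :: F) s ↔ s a = s b ∧ Flagged F s := by
  simp [Flagged]

theorem flagged_update {F : List (ℕ × ℕ)} {v : ℕ} (hv : v ∉ flagVars F) (s : ℕ → M) (m : M) :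
    Flagged F (Function.update s v m) ↔ Flagged F s := by
  refine forall₂_congr fun p hp => ?_
  have h1 : p.1 ≠ v := fun e => hv ⟨p, hp, Or.inl e.symm⟩
  have h2 : p.2 ≠ v := fun e => hv ⟨p, hp, Or.inr e.symm⟩
  simp [h1, h2]

theorem litCneg_guard (F : List (ℕ × ℕ)) {θ : TS S ι ar} (h : LitCneg θ) :
    LitCneg (guard F θ) := by
  induction F with
  | nil => exact h
  | cons p F ih => exact ⟨trivial, ih⟩

theorem cnegs_guard (F : List (ℕ × ℕ)) (θ : TS S ι ar) : cnegs (guard F θ) = cnegs θ := by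
  induction F with
  | nil => rfl
  | cons p F ih => simpa [guard, cnegs] using ih

theorem fv_guard (F : List (ℕ × ℕ)) (θ : TS S ι ar) :
    fv (guard F θ) = fv θ ∪ flagVars F := by
  induction F with
  | nil => simp [guard, flagVars]
  | cons p F ih =>
    obtain ⟨a, b⟩ := p
    rw [flagVars_cons]
    change {a, b} ∪ fv (guard F θ) = _
    rw [ih, Set.union_left_comm]

theorem tsat_guard {I : Interp S M} {A : ∀ i, Set (Fin (ar i) → M) → Prop}
    (F : List (ℕ × ℕ)) {θ : TS S ι ar} {P : (ℕ → M) → Prop}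
    (hθ : ∀ X, TSat M I A θ X ↔ ∀ s ∈ X, P s) (X : Set (ℕ → M)) :
    TSat M I A (guard F θ) X ↔ ∀ s ∈ X, Flagged F s → P s := by
  induction F generalizing X with
  | nil => simp [guard, hθ, Flagged]
  | cons p F ih =>
    obtain ⟨a, b⟩ := p
    simp only [flagged_cons]
    constructor
    · rintro ⟨Y, Z, rfl, hY, hZ⟩ s (hs | hs) ⟨e, hF⟩
      · exact absurd e (hY s hs)
      · exact (ih Z).1 hZ s hs hF
    · intro h
      refine ⟨{s ∈ X | s a ≠ s b}, {s ∈ X | s a = s b}, ?_, fun s hs => hs.2,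
        (ih _).2 fun s hs hF => h s hs.1 ⟨hs.2, hF⟩⟩
      ext s
      by_cases e : s a = s b <;> simp [e]

theorem tsat_unflagged {I : Interp S M} {A : ∀ i, Set (Fin (ar i) → M) → Prop}
    {F : List (ℕ × ℕ)} {a b : ℕ} (hab : (a, b) ∈ F) (X : Set (ℕ → M)) :
    TSat M I A (guard F (.neq a b)) X ↔ ∀ s ∈ X, ¬ Flagged F s := by
  rw [tsat_guard F (P := fun s => s a ≠ s b) fun X => Iff.rfl]
  exact forall₂_congr fun s _ => ⟨fun h hF => h hF (hF _ hab), fun h hF => absurd hF h⟩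

/-- `X'` is a version of `X` (up to the values outside `V`) in which the unflagged assignments
already account for all of `X`, and all flagged assignments agree with `s`. -/
structure FlagCopy (F : List (ℕ × ℕ)) (V : Set ℕ) (X X' : Set (ℕ → M)) (s : ℕ → M) : Prop where
  covers : Covers V X' X
  unflagged : Covers V X {x ∈ X' | ¬ Flagged F x}
  flagged : ∀ x ∈ X', Flagged F x → Set.EqOn x s V

theorem FlagCopy.mono {F : List (ℕ × ℕ)} {V W : Set ℕ} {X X' : Set (ℕ → M)} {s : ℕ → M}
    (h : FlagCopy F W X X' s) (hVW : V ⊆ W) : FlagCopy F V X X' s :=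
  ⟨h.covers.mono hVW, h.unflagged.mono hVW, fun x hx hF => (h.flagged x hx hF).mono hVW⟩

theorem FlagCopy.covers_symm {F : List (ℕ × ℕ)} {V : Set ℕ} {X X' : Set (ℕ → M)} {s : ℕ → M}
    (h : FlagCopy F V X X' s) : Covers V X X' := fun x hx =>
  let ⟨y, hy, e⟩ := h.unflagged x hx
  ⟨y, hy.1, e⟩

/-- `φ` can be replaced by a formula with fewer contradictory negations, one of them being witnessed
by flagged assignments instead. -/
def Reducible (φ : TS S ι ar) : Prop :=
  ∀ (F : List (ℕ × ℕ)) (a b : ℕ), (a, b) ∈ F → (∀ n ∈ flagVars F, varBound φ ≤ n) →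
    ∃ φ' : TS S ι ar, LitCneg φ' ∧ cnegs φ' < cnegs φ ∧ fv φ' ⊆ fv φ ∪ flagVars F ∧
      ∀ (M : Type) (I : Interp S M) (A : ∀ i, Set (Fin (ar i) → M) → Prop),
        (∀ X, (∃ x ∈ X, Flagged F x) → TSat M I A φ' X → TSat M I A φ X) ∧
        (∀ X, TSat M I A φ X →
          ∃ s ∈ X, ∀ X', FlagCopy F (fv φ) X X' s → TSat M I A φ' X')

theorem reducible_cneg {α : TS S ι ar} (h : IsLit α) : Reducible (.cneg α) := by
  intro F a b _ _
  refine ⟨guard F α.nneg, litCneg_guard F h.litCneg_nneg, ?_, ?_, fun M I A => ⟨?_, ?_⟩⟩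
  · rw [cnegs_guard, h.cnegs_nneg]; exact Nat.succ_pos _
  · rw [fv_guard, h.fv_nneg]; rfl
  · rintro X ⟨x, hx, hF⟩ h1 h2
    exact (tsat_guard F h.tsat_nneg_iff X).1 h1 x hx hF ((h.tsat_iff X).1 h2 x hx)
  · intro X hX
    have hX' : ¬ ∀ s ∈ X, FSat M I s α := fun h' => hX ((h.tsat_iff X).2 h')
    push Not at hX'
    obtain ⟨s, hs, hn⟩ := hX'
    refine ⟨s, hs, fun X' hX' => (tsat_guard F h.tsat_nneg_iff X').2 fun x hx hF hα => hn ?_⟩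
    exact h.fsat_congr (hX'.flagged x hx hF) hα

theorem Reducible.and_left {φ ψ : TS S ι ar} (hφ : Reducible φ) (hψ : LitCneg ψ) :
    Reducible (.and φ ψ) := by
  intro F a b hab hF
  obtain ⟨φ', h1, h2, h3, h4⟩ :=
    hφ F a b hab fun n hn => (le_max_left _ _).trans (hF n hn)
  refine ⟨.and φ' ψ, ⟨h1, hψ⟩, Nat.add_lt_add_right h2 _, ?_, fun M I A => ⟨?_, ?_⟩⟩
  · rintro n (hn | hn)
    · exact (h3 hn).imp Or.inl id
    · exact Or.inl (Or.inr hn)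
  · exact fun X hX h => ⟨(h4 M I A).1 X hX h.1, h.2⟩
  · rintro X ⟨hX, hX2⟩
    obtain ⟨s, hs, h⟩ := (h4 M I A).2 X hX
    refine ⟨s, hs, fun X' hX' => ⟨h X' (hX'.mono Set.subset_union_left), ?_⟩⟩
    exact TSat.local I A ψ X X' (hX'.covers_symm.mono Set.subset_union_right)
      (hX'.covers.mono Set.subset_union_right) hX2

theorem Reducible.or_left {φ ψ : TS S ι ar} (hφ : Reducible φ) (hψ : LitCneg ψ) :
    Reducible (.or φ ψ) := by
  intro F a b hab hF
  obtain ⟨φ', h1, h2, h3, h4⟩ :=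
    hφ F a b hab fun n hn => (le_max_left _ _).trans (hF n hn)
  refine ⟨.or φ' (.and ψ (guard F (.neq a b))), ⟨h1, hψ, litCneg_guard F trivial⟩, ?_, ?_,
    fun M I A => ⟨?_, ?_⟩⟩
  · simp only [cnegs, cnegs_guard]; omega
  · rintro n (hn | hn | hn)
    · exact (h3 hn).imp Or.inl id
    · exact Or.inl (Or.inr hn)
    · rw [fv_guard] at hn
      rcases hn with (rfl | rfl) | hn
      · exact Or.inr ⟨_, hab, Or.inl rfl⟩
      · exact Or.inr ⟨_, hab, Or.inr rfl⟩
      · exact Or.inr hn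
  · rintro X ⟨x, hx, hxF⟩ ⟨Y, Z, rfl, hY, hZ, hZ'⟩
    rw [tsat_unflagged hab] at hZ'
    have hxY : x ∈ Y := hx.resolve_right fun h => hZ' x h hxF
    exact ⟨Y, Z, rfl, (h4 M I A).1 Y ⟨x, hxY, hxF⟩ hY, hZ⟩
  · rintro X ⟨Y, Z, rfl, hY, hZ⟩
    obtain ⟨s, hs, h⟩ := (h4 M I A).2 Y hY
    refine ⟨s, Or.inl hs, fun X' hX' => ?_⟩
    refine ⟨{x ∈ X' | ∃ y ∈ Y, Set.EqOn x y (fv (TS.or φ ψ))},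
      {x ∈ X' | ¬ Flagged F x ∧ ∃ z ∈ Z, Set.EqOn x z (fv (TS.or φ ψ))}, ?_,
      h _ (FlagCopy.mono (W := fv (TS.or φ ψ)) ⟨?_, ?_, ?_⟩ Set.subset_union_left),
      TSat.local I A ψ Z _ ?_ ?_ hZ, (tsat_unflagged hab _).2 fun x hx => hx.2.1⟩
    · ext x
      constructor
      · rintro (h | h) <;> exact h.1
      · intro hx
        by_cases hxF : Flagged F x
        · exact Or.inl ⟨hx, s, hs, hX'.flagged x hx hxF⟩
        · obtain ⟨w, hw | hw, e⟩ := hX'.covers x hx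
          · exact Or.inl ⟨hx, w, hw, e⟩
          · exact Or.inr ⟨hx, hxF, w, hw, e⟩
    · exact fun x hx => hx.2
    · intro y hy
      obtain ⟨x, ⟨hx, hxF⟩, e⟩ := hX'.unflagged y (Or.inl hy)
      exact ⟨x, ⟨⟨hx, y, hy, e.symm⟩, hxF⟩, e⟩
    · exact fun x hx => hX'.flagged x hx.1
    · refine Covers.mono (W := fv (TS.or φ ψ)) (fun z hz => ?_) Set.subset_union_right
      obtain ⟨x, ⟨hx, hxF⟩, e⟩ := hX'.unflagged z (Or.inr hz)
      exact ⟨x, ⟨hx, hxF, z, hz, e.symm⟩, e⟩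
    · exact Covers.mono (W := fv (TS.or φ ψ)) (fun x hx => hx.2.2) Set.subset_union_right

theorem Reducible.and_comm {φ ψ : TS S ι ar} (h : Reducible (.and φ ψ)) :
    Reducible (.and ψ φ) := by
  intro F a b hab hF
  obtain ⟨φ', h1, h2, h3, h4⟩ := h F a b hab (by simpa only [varBound, max_comm] using hF)
  refine ⟨φ', h1, by simpa only [cnegs, add_comm] using h2,
    by simpa only [fv, Set.union_comm] using h3, fun M I A => ?_⟩
  have e : ∀ X, TSat M I A (.and ψ φ) X ↔ TSat M I A (.and φ ψ) X := fun X =>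
    _root_.and_comm
  simpa only [e, fv, Set.union_comm] using h4 M I A

theorem Reducible.or_comm {φ ψ : TS S ι ar} (h : Reducible (.or φ ψ)) :
    Reducible (.or ψ φ) := by
  intro F a b hab hF
  obtain ⟨φ', h1, h2, h3, h4⟩ := h F a b hab (by simpa only [varBound, max_comm] using hF)
  refine ⟨φ', h1, by simpa only [cnegs, add_comm] using h2,
    by simpa only [fv, Set.union_comm] using h3, fun M I A => ?_⟩
  have e : ∀ X, TSat M I A (.or ψ φ) X ↔ TSat M I A (.or φ ψ) X := fun X =>
    ⟨fun ⟨Y, Z, h, hY, hZ⟩ => ⟨Z, Y, Set.union_comm Z Y ▸ h, hZ, hY⟩,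
      fun ⟨Y, Z, h, hY, hZ⟩ => ⟨Z, Y, Set.union_comm Z Y ▸ h, hZ, hY⟩⟩
  simpa only [e, fv, Set.union_comm] using h4 M I A

theorem Reducible.ex {φ : TS S ι ar} (hφ : Reducible φ) (v : ℕ) : Reducible (.ex v φ) := by
  intro F a b hab hF
  obtain ⟨φ', h1, h2, h3, h4⟩ :=
    hφ F a b hab fun n hn => (le_max_right _ _).trans (hF n hn)
  have hv : v ∉ flagVars F := fun h =>
    absurd ((le_max_left _ _).trans (hF v h)) (Nat.not_succ_le_self v)
  refine ⟨.ex v φ', h1, h2, ?_, fun M I A => ⟨?_, ?_⟩⟩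
  · rintro n ⟨hn, hnv⟩
    exact (h3 hn).imp (fun h => ⟨h, hnv⟩) id
  · rintro X ⟨x, hx, hxF⟩ ⟨H, hH, h⟩
    obtain ⟨m, hm⟩ := hH x hx
    exact ⟨H, hH, (h4 M I A).1 _ ⟨_, ⟨x, hx, m, hm, rfl⟩, (flagged_update hv x m).2 hxF⟩ h⟩
  · rintro X ⟨H, hH, h⟩
    obtain ⟨_, ⟨s, hs, m, hm, rfl⟩, hT⟩ := (h4 M I A).2 _ h
    refine ⟨s, hs, fun X' hX' => ?_⟩
    refine ⟨fun x => {k | (Flagged F x ∧ k = m) ∨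
      (¬ Flagged F x ∧ ∃ y ∈ X, Set.EqOn x y (fv φ \ {v}) ∧ k ∈ H y)}, ?_, hT _ ⟨?_, ?_, ?_⟩⟩
    · intro x hx
      by_cases hxF : Flagged F x
      · exact ⟨m, Or.inl ⟨hxF, rfl⟩⟩
      · obtain ⟨y, hy, e⟩ := hX'.covers x hx
        obtain ⟨k, hk⟩ := hH y hy
        exact ⟨k, Or.inr ⟨hxF, y, hy, e, hk⟩⟩
    · rintro _ ⟨x, hx, k, ⟨hxF, rfl⟩ | ⟨_, y, hy, e, hk⟩, rfl⟩
      · exact ⟨_, ⟨s, hs, k, hm, rfl⟩, eqOn_update (hX'.flagged x hx hxF) k⟩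
      · exact ⟨_, ⟨y, hy, k, hk, rfl⟩, eqOn_update e k⟩
    · rintro _ ⟨y, hy, k, hk, rfl⟩
      obtain ⟨x, ⟨hx, hxF⟩, e⟩ := hX'.unflagged y hy
      exact ⟨_, ⟨⟨x, hx, k, Or.inr ⟨hxF, y, hy, e.symm, hk⟩, rfl⟩,
        fun h => hxF ((flagged_update hv x k).1 h)⟩, eqOn_update e k⟩
    · rintro _ ⟨x, hx, k, ⟨hxF, rfl⟩ | ⟨hxF, _⟩, rfl⟩ hF'
      · exact eqOn_update (hX'.flagged x hx hxF) k
      · exact absurd ((flagged_update hv x k).1 hF') hxF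

theorem exists_fresh (F : List (ℕ × ℕ)) (n : ℕ) :
    ∃ N, n ≤ N ∧ ∀ k ∈ flagVars F, k < N := by
  induction F with
  | nil => exact ⟨n, le_rfl, by simp [flagVars]⟩
  | cons p F ih =>
    obtain ⟨a, b⟩ := p
    obtain ⟨N, hN, h⟩ := ih
    refine ⟨N + a + b + 1, by omega, ?_⟩
    rw [flagVars_cons]
    rintro k ((rfl | rfl) | hk)
    · omega
    · omega
    · have := h k hk; omega

/-- `∀v φ` becomes `∃u ∀v ∃z (z = v ∧ φ')`, where the flagged assignments are now also required
to satisfy `z = u`. -/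
theorem Reducible.al {φ : TS S ι ar} (hφ : Reducible φ) (v : ℕ) : Reducible (.al v φ) := by
  intro F a b hab hF
  have hv : v ∉ flagVars F := fun h =>
    absurd ((le_max_left _ _).trans (hF v h)) (Nat.not_succ_le_self v)
  obtain ⟨u, hu, huF⟩ := exists_fresh F (max (v + 1) (varBound φ))
  obtain ⟨hvu, hφu⟩ := max_le_iff.1 hu
  obtain ⟨z, rfl⟩ : ∃ z, z = u + 1 := ⟨_, rfl⟩
  have hu' : u ∉ flagVars F := fun h => lt_irrefl _ (huF u h)
  have hz' : u + 1 ∉ flagVars F := fun h => absurd (huF _ h) (by omega)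
  have huV : u ∉ fv φ := fun h => absurd (lt_varBound φ u h) (by omega)
  have hzV : u + 1 ∉ fv φ := fun h => absurd (lt_varBound φ _ h) (by omega)
  obtain ⟨φ', h1, h2, h3, h4⟩ := hφ ((u + 1, u) :: F) a b (List.mem_cons_of_mem _ hab) (by
    rw [flagVars_cons]
    rintro n ((rfl | rfl) | hn)
    · omega
    · omega
    · exact (le_max_right _ _).trans (hF n hn))
  have hflag : ∀ {M : Type} (x : ℕ → M) (p q r : M), Flagged ((u + 1, u) :: F)
      (Function.update (Function.update (Function.update x u p) v q) (u + 1) r) ↔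
        r = p ∧ Flagged F x := by
    intro M x p q r
    rw [flagged_cons, flagged_update hz', flagged_update hv, flagged_update hu']
    have e1 : u ≠ v := by omega
    simp [e1]
  have hagree : ∀ {M : Type} (x : ℕ → M) (p q r : M), Set.EqOn
      (Function.update (Function.update (Function.update x u p) v q) (u + 1) r)
      (Function.update x v q) (fv φ) := by
    intro M x p q r
    exact (eqOn_update_left hzV _ r).trans
      (eqOn_update (eqOn_update_left (fun h => huV h.1) x p) q)
  refine ⟨.ex u (.al v (.ex (u + 1) (.and (.eq (u + 1) v) φ'))), ⟨trivial, h1⟩, ?_, ?_,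
    fun M I A => ⟨?_, ?_⟩⟩
  · simpa only [cnegs, zero_add] using h2
  · rintro n ⟨⟨⟨(rfl | rfl) | hn, hnz⟩, hnv⟩, hnu⟩
    · exact absurd rfl hnz
    · exact absurd rfl hnv
    · rcases h3 hn with hn | hn
      · exact Or.inl ⟨hn, hnv⟩
      · rw [flagVars_cons] at hn
        rcases hn with (rfl | rfl) | hn
        · exact absurd rfl hnz
        · exact absurd rfl hnu
        · exact Or.inr hn
  · rintro X ⟨x, hx, hxF⟩ ⟨H, hH, K, hK, heq, h⟩
    have hKx : ∀ y ∈ X, ∀ p ∈ H y, ∀ q : M, ∃ r ∈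
        K (Function.update (Function.update y u p) v q), r = q := by
      intro y hy p hp q
      obtain ⟨r, hr⟩ := hK _ ⟨_, ⟨y, hy, p, hp, rfl⟩, q, rfl⟩
      have := heq _ ⟨_, ⟨_, ⟨y, hy, p, hp, rfl⟩, q, rfl⟩, r, hr, rfl⟩
      have e : v ≠ u + 1 := by omega
      simp only [Function.update_self, Function.update_of_ne e] at this
      exact ⟨r, hr, this⟩
    refine TSat.local I A φ _ _ ?_ ?_ ((h4 M I A).1 _ ?_ h)
    · rintro _ ⟨_, ⟨_, ⟨y, hy, p, hp, rfl⟩, q, rfl⟩, r, hr, rfl⟩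
      exact ⟨_, ⟨y, hy, q, rfl⟩, hagree y p q r⟩
    · rintro _ ⟨y, hy, q, rfl⟩
      obtain ⟨p, hp⟩ := hH y hy
      obtain ⟨r, hr, _⟩ := hKx y hy p hp q
      exact ⟨_, ⟨_, ⟨_, ⟨y, hy, p, hp, rfl⟩, q, rfl⟩, r, hr, rfl⟩, (hagree y p q r).symm⟩
    · obtain ⟨p, hp⟩ := hH x hx
      obtain ⟨r, hr, e⟩ := hKx x hx p hp p
      exact ⟨_, ⟨_, ⟨_, ⟨x, hx, p, hp, rfl⟩, p, rfl⟩, r, hr, rfl⟩,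
        (hflag x p p r).2 ⟨e, hxF⟩⟩
  · intro X hX
    obtain ⟨_, ⟨s, hs, m, rfl⟩, hT⟩ := (h4 M I A).2 _ hX
    refine ⟨s, hs, fun X' hX' => ?_⟩
    refine ⟨fun _ => {m}, fun _ _ => ⟨m, rfl⟩, fun x => {x v}, fun x _ => ⟨x v, rfl⟩, ?_,
      hT _ ⟨?_, ?_, ?_⟩⟩
    · rintro _ ⟨x, _, r, rfl, rfl⟩
      have e : v ≠ u + 1 := by omega
      simp [e]
    · rintro _ ⟨_, ⟨_, ⟨x, hx, p, rfl, rfl⟩, q, rfl⟩, r, hr, rfl⟩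
      obtain ⟨y, hy, e⟩ := hX'.covers x hx
      exact ⟨_, ⟨y, hy, q, rfl⟩, (hagree x _ q r).trans (eqOn_update e q)⟩
    · rintro _ ⟨y, hy, q, rfl⟩
      obtain ⟨x, ⟨hx, hxF⟩, e⟩ := hX'.unflagged y hy
      refine ⟨_, ⟨⟨_, ⟨_, ⟨x, hx, m, rfl, rfl⟩, q, rfl⟩, _, rfl, rfl⟩, fun h => ?_⟩,
        (eqOn_update e q).trans (hagree x m q _).symm⟩
      exact hxF ((hflag x m q _).1 h).2
    · rintro _ ⟨_, ⟨_, ⟨x, hx, p, rfl, rfl⟩, q, rfl⟩, r, hr, rfl⟩ hF'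
      obtain ⟨rfl, hxF⟩ := (hflag x _ q r).1 hF'
      have hq : r = q := by simpa using hr
      subst hq
      exact (hagree x r r r).trans (eqOn_update (hX'.flagged x hx hxF) r)

theorem LitCneg.reducible {φ : TS S ι ar} (h : LitCneg φ) (h0 : 0 < cnegs φ) :
    Reducible φ := by
  induction φ with
  | rel => exact absurd h0 (lt_irrefl 0)
  | nrel => exact absurd h0 (lt_irrefl 0)
  | eq => exact absurd h0 (lt_irrefl 0)
  | neq => exact absurd h0 (lt_irrefl 0)
  | dep => exact absurd h0 (lt_irrefl 0)
  | gdisj => exact h.elim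
  | cneg α => exact reducible_cneg h
  | and φ ψ ihφ ihψ =>
    by_cases hφ : 0 < cnegs φ
    · exact (ihφ h.1 hφ).and_left h.2
    · exact ((ihψ h.2 (by simp only [cnegs] at h0; omega)).and_left h.1).and_comm
  | or φ ψ ihφ ihψ =>
    by_cases hφ : 0 < cnegs φ
    · exact (ihφ h.1 hφ).or_left h.2
    · exact ((ihψ h.2 (by simp only [cnegs] at h0; omega)).or_left h.1).or_comm
  | ex v φ ih => exact (ih h h0).ex v
  | al v φ ih => exact (ih h h0).al v

theorem tTrue_al {I : Interp S M} {A : ∀ i, Set (Fin (ar i) → M) → Prop} (v : ℕ)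
    (φ : TS S ι ar) : TTrue M I A (.al v φ) ↔ TTrue M I A φ := by
  have : {s' : ℕ → M | ∃ s ∈ (Set.univ : Set (ℕ → M)), ∃ m : M, s' = Function.update s v m} =
      Set.univ :=
    Set.eq_univ_of_forall fun s => ⟨s, trivial, s v, (Function.update_eq_self v s).symm⟩
  simp only [TTrue, TSat, this]

/-- Every sentence in which the contradictory negation occurs only in front of first-order literals
is equivalent to one without contradictory negation. -/
theorem LitCneg.exists_plain (φ : TS S ι ar) (h : LitCneg φ) (hs : IsSentence φ) :
    ∃ ψ : TS S ι ar, IsSentence ψ ∧ Plain ψ ∧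
      ∀ (M : Type), Nontrivial M → ∀ (I : Interp S M) (A : ∀ i, Set (Fin (ar i) → M) → Prop),
        (TTrue M I A φ ↔ TTrue M I A ψ) := by
  induction hn : cnegs φ using Nat.strong_induction_on generalizing φ with
  | _ n ih =>
  subst hn
  rcases Nat.eq_zero_or_pos (cnegs φ) with h0 | h0
  · exact ⟨φ, hs, h.plain h0, fun _ _ _ _ => Iff.rfl⟩
  set a := varBound φ with ha
  obtain ⟨φ', h1, h2, h3, h4⟩ := h.reducible h0 [(a, a + 1)] a (a + 1) (by simp) (by
    rw [flagVars_cons]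
    rintro n ((rfl | rfl) | ⟨p, hp, _⟩)
    · exact le_rfl
    · exact Nat.le_succ _
    · exact absurd hp List.not_mem_nil)
  have hs' : IsSentence (TS.al a (TS.al (a + 1) φ')) := by
    refine Set.eq_empty_of_forall_notMem ?_
    rintro n ⟨⟨hn, hb⟩, ha⟩
    rw [hs, flagVars_cons] at h3
    rcases h3 hn with hn | (hn | hn) | ⟨p, hp, _⟩
    · exact hn
    · exact ha hn
    · exact hb hn
    · exact absurd hp List.not_mem_nil
  obtain ⟨ψ, hψ, hp, e⟩ := ih (cnegs φ') h2 (.al a (.al (a + 1) φ')) h1 hs' rfl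
  refine ⟨ψ, hψ, hp, fun M hM I A => ?_⟩
  rw [← e M hM I A, tTrue_al, tTrue_al]
  obtain ⟨m, m', hm⟩ := hM.exists_pair_ne
  constructor
  · intro hφ
    obtain ⟨s, _, hT⟩ := (h4 M I A).2 _ hφ
    refine hT _ ?_
    rw [hs]
    refine ⟨fun x _ => ⟨x, trivial, fun _ h => h.elim⟩, fun x _ => ?_,
      fun _ _ _ _ h => h.elim⟩
    refine ⟨Function.update (fun _ => m) a m', ⟨trivial, fun hF => hm ?_⟩, fun _ h => h.elim⟩
    have := ((flagged_cons _ _ _ _).1 hF).1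
    simpa using this.symm
  · exact (h4 M I A).1 _ ⟨fun _ => m, trivial, fun _ _ => rfl⟩

end Flags

/-! ### Translations between `FO(∼₀, 𝒟)` and `FO(𝒟, ∼𝒟)` -/

section Translations

variable {S : Signature} {ι : Type} {ar : ι → ℕ}

/-- Replace the atoms of `∼𝒟` by contradictory negations of atoms of `𝒟`. -/
def complToCneg : TS S (ι ⊕ ι) (Sum.elim ar ar) → TS S ι ar
  | .rel r v => .rel r v
  | .nrel r v => .nrel r v
  | .eq x y => .eq x y
  | .neq x y => .neq x y
  | .dep (.inl i) v => .dep i v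
  | .dep (.inr i) v => .cneg (.dep i v)
  | .and φ ψ => .and (complToCneg φ) (complToCneg ψ)
  | .or φ ψ => .or (complToCneg φ) (complToCneg ψ)
  | .gdisj φ ψ => .gdisj (complToCneg φ) (complToCneg ψ)
  | .cneg φ => .cneg (complToCneg φ)
  | .ex v φ => .ex v (complToCneg φ)
  | .al v φ => .al v (complToCneg φ)

/-- Replace contradictory negations of atoms of `𝒟` by atoms of `∼𝒟`. -/
def cnegToCompl : TS S ι ar → TS S (ι ⊕ ι) (Sum.elim ar ar)
  | .rel r v => .rel r v
  | .nrel r v => .nrel r v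
  | .eq x y => .eq x y
  | .neq x y => .neq x y
  | .dep i v => .dep (.inl i) v
  | .and φ ψ => .and (cnegToCompl φ) (cnegToCompl ψ)
  | .or φ ψ => .or (cnegToCompl φ) (cnegToCompl ψ)
  | .gdisj φ ψ => .gdisj (cnegToCompl φ) (cnegToCompl ψ)
  | .cneg (.dep i v) => .dep (.inr i) v
  | .cneg φ => .cneg (cnegToCompl φ)
  | .ex v φ => .ex v (cnegToCompl φ)
  | .al v φ => .al v (cnegToCompl φ)

theorem fv_complToCneg (φ : TS S (ι ⊕ ι) (Sum.elim ar ar)) : fv (complToCneg φ) = fv φ := by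
  induction φ with
  | dep i v => cases i <;> rfl
  | _ => simp_all [complToCneg, fv]

theorem cneg0_complToCneg {φ : TS S (ι ⊕ ι) (Sum.elim ar ar)} (h : Plain φ) :
    Cneg0 (complToCneg φ) := by
  unfold Plain at h
  induction φ with
  | dep i v => cases i <;> trivial
  | _ => simp_all [complToCneg, Cneg0, NoCneg, NoGdisj]

theorem tsat_complToCneg (D : ∀ i, DepPred (ar i)) {M : Type} (I : Interp S M)
    (φ : TS S (ι ⊕ ι) (Sum.elim ar ar)) (X : Set (ℕ → M)) :
    TSat M I (fun i => D i M) (complToCneg φ) X ↔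
      TSat M I (fun i => withComplFam D i M) φ X := by
  induction φ generalizing X with
  | dep i v => cases i <;> rfl
  | _ => simp_all [complToCneg, TSat]

theorem fv_cnegToCompl {φ : TS S ι ar} (h : Cneg0 φ) : fv (cnegToCompl φ) = fv φ := by
  induction φ with
  | cneg φ => cases φ <;> first | rfl | exact h.elim
  | _ => simp_all [cnegToCompl, fv, Cneg0]

theorem litCneg_cnegToCompl {φ : TS S ι ar} (h : Cneg0 φ) : LitCneg (cnegToCompl φ) := by
  induction φ with
  | cneg φ => cases φ <;> trivial
  | _ => simp_all [cnegToCompl, LitCneg, Cneg0]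

theorem tsat_cnegToCompl (D : ∀ i, DepPred (ar i)) {M : Type} (I : Interp S M)
    {φ : TS S ι ar} (h : Cneg0 φ) (X : Set (ℕ → M)) :
    TSat M I (fun i => withComplFam D i M) (cnegToCompl φ) X ↔
      TSat M I (fun i => D i M) φ X := by
  induction φ generalizing X with
  | dep i v => rfl
  | cneg φ => cases φ <;> first | rfl | exact h.elim
  | _ => simp_all [cnegToCompl, TSat, Cneg0]

end Translations

/-- `FO(∼₀, 𝒟) ≡ FO` if and only if `FO(𝒟, ∼𝒟) ≡ FO`. -/
theorem cneg0_iff_with_complements {ι : Type} {ar : ι → ℕ}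
    (D : ∀ i, DepPred (ar i)) (hiso : ∀ i, IsoClosed (D i)) :
    (∀ (S : Signature) (φ : TS S ι ar), IsSentence φ → Cneg0 φ →
      ∃ ψ : FOF S, IsSentence ψ ∧
        ∀ (M : Type), Nontrivial M → ∀ I : Interp S M,
          (TTrue M I (fun i => D i M) φ ↔ FOTrue M I ψ))
    ↔ SFOFam (withComplFam D) := by
  constructor
  · intro H S φ hs hp
    obtain ⟨ψ, hψ, e⟩ :=
      H S (complToCneg φ) ((fv_complToCneg φ).trans hs) (cneg0_complToCneg hp)
    exact ⟨ψ, hψ, fun M hM I => (tsat_complToCneg D I φ _).symm.trans (e M hM I)⟩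
  · intro H S φ hs hc
    obtain ⟨χ, hχ, hp, e⟩ := LitCneg.exists_plain (cnegToCompl φ) (litCneg_cnegToCompl hc)
      ((fv_cnegToCompl hc).trans hs)
    obtain ⟨ψ, hψ, e'⟩ := H S χ hχ hp
    exact ⟨ψ, hψ, fun M hM I => (tsat_cnegToCompl D I hc _).symm.trans
      ((e M hM I _).trans (e' M hM I))⟩

end DSFO
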